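/- Let α, β > 0 be real and let N be an integer with N > α²/(4π²β). Then there exist constants C > 0 and y₀ > 0 such that for every y with 0 < y < y₀, Σ_{n ≥ N} n^{−α/2} exp(2π√(βn) − πny) ≤ C · y^{α − 3/2} · e^{πβ/y}. -/

import Mathlib

lemma rpow_neg_le_mul_exp_div {a c y : ℝ} (ha : 0 < a) (hc : 0 < c) (hy : 0 < y) :
    y ^ (-a) ≤ (a / c) ^ a * Real.exp (c / y) := by
  have h1 : c / (y * a) ≤ Real.exp (c / (y * a)) := by
    linarith [Real.add_one_le_exp (c / (y * a))]
  have h2 : (c / (y * a)) ^ a ≤ Real.exp (c / y) := by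
    refine (Real.rpow_le_rpow (by positivity) h1 ha.le).trans_eq ?_
    rw [← Real.exp_mul]
    congr 1
    field_simp
  calc y ^ (-a) = (a / c * (c / (y * a))) ^ a := by
        rw [Real.rpow_neg hy.le, ← Real.inv_rpow hy.le]
        congr 1
        field_simp
    _ = (a / c) ^ a * (c / (y * a)) ^ a := Real.mul_rpow (by positivity) (by positivity)
    _ ≤ _ := by gcongr

lemma div_le_arctan_add_sub_arctan {x d : ℝ} (hd : 0 ≤ d) (hd1 : d ≤ 1) :
    d / (3 * (1 + x ^ 2)) ≤ Real.arctan (x + d) - Real.arctan x := by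
  have h := (convex_Icc x (x + d)).mul_sub_le_image_sub_of_le_deriv
    (C := 1 / (3 * (1 + x ^ 2))) (f := Real.arctan) Real.continuous_arctan.continuousOn
    Real.differentiable_arctan.differentiableOn ?_ x (by simp [hd]) (x + d) (by simp [hd])
    (by linarith)
  · calc d / (3 * (1 + x ^ 2)) = 1 / (3 * (1 + x ^ 2)) * (x + d - x) := by ring
      _ ≤ _ := h
  · intro t ht
    rw [interior_Icc] at ht
    rw [Real.deriv_arctan]
    have : (t - x) ^ 2 ≤ 1 := by
      rw [sq_le_one_iff₀ (by linarith [ht.1])]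
      linarith [ht.2]
    apply one_div_le_one_div_of_le (by positivity)
    nlinarith [sq_nonneg (t - 2 * x)]

lemma rpow_neg_le_mul_exp_sq_div {a b w y : ℝ} (ha : 0 < a) (hb : 0 < b) (hy : 0 < y)
    (hyw : y ≤ w) :
    w ^ (-a) ≤ ((4 * a / b ^ 2) ^ a + (b / 2) ^ (-a)) * Real.exp ((w - b) ^ 2 / y) := by
  rw [add_mul]
  rcases le_total w (b / 2) with h | h
  · have h1 : w ^ (-a) ≤ (4 * a / b ^ 2) ^ a * Real.exp ((w - b) ^ 2 / y) := by
      calc w ^ (-a) ≤ y ^ (-a) := Real.rpow_le_rpow_of_nonpos hy hyw (by linarith)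
        _ ≤ (a / (b ^ 2 / 4)) ^ a * Real.exp (b ^ 2 / 4 / y) :=
          rpow_neg_le_mul_exp_div ha (by positivity) hy
        _ ≤ _ := by
          have : a / (b ^ 2 / 4) = 4 * a / b ^ 2 := by field_simp
          rw [this]
          gcongr
          nlinarith
    have : 0 ≤ (b / 2) ^ (-a) * Real.exp ((w - b) ^ 2 / y) := by positivity
    linarith
  · have h1 : w ^ (-a) ≤ (b / 2) ^ (-a) * Real.exp ((w - b) ^ 2 / y) := by
      refine (Real.rpow_le_rpow_of_nonpos (by positivity) h (by linarith)).trans ?_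
      exact le_mul_of_one_le_right (by positivity) (Real.one_le_exp (by positivity))
    have : 0 ≤ (4 * a / b ^ 2) ^ a * Real.exp ((w - b) ^ 2 / y) := by positivity
    linarith

lemma le_mul_exp_sq_div {b w y : ℝ} (hb : 0 < b) (hy : 0 < y) (hy1 : y ≤ 1) :
    w ≤ (b + 1) * Real.exp ((w - b) ^ 2 / y) := by
  have h1 : (w - b) ^ 2 ≤ (w - b) ^ 2 / y := le_div_self (sq_nonneg _) hy hy1
  have h2 := Real.add_one_le_exp ((w - b) ^ 2 / y)
  have h3 : 1 ≤ Real.exp ((w - b) ^ 2 / y) := Real.one_le_exp (by positivity)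
  nlinarith [sq_nonneg (w - b - 1)]

lemma rpow_neg_mul_exp_neg_le {a b w y : ℝ} (ha : 0 < a) (hb : 0 < b) (hy : 0 < y)
    (hy1 : y ≤ 1) (hyw : y ≤ w) :
    w ^ (-a) * Real.exp (-(Real.pi * ((w - b) ^ 2 / y))) ≤
      ((4 * a / b ^ 2) ^ a + (b / 2) ^ (-a)) * (b + 1) / (w * (1 + (w - b) ^ 2 / y)) := by
  have h1 := rpow_neg_le_mul_exp_sq_div ha hb hy hyw
  have h2 := le_mul_exp_sq_div (w := w) hb hy hy1
  have hw : 0 < w := hy.trans_le hyw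
  have hz : 0 ≤ (w - b) ^ 2 / y := by positivity
  set z := (w - b) ^ 2 / y
  set K := (4 * a / b ^ 2) ^ a + (b / 2) ^ (-a)
  have hK : 0 ≤ K := by positivity
  have h3 : 1 + z ≤ Real.exp z := by linarith [Real.add_one_le_exp z]
  rw [le_div_iff₀ (by positivity)]
  calc w ^ (-a) * Real.exp (-(Real.pi * z)) * (w * (1 + z))
      ≤ (K * Real.exp z) * Real.exp (-(3 * z)) * (((b + 1) * Real.exp z) * Real.exp z) := by
        gcongr
        exact Real.pi_gt_three.le
    _ = K * (b + 1) * Real.exp (z + -(3 * z) + z + z) := by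
        simp only [Real.exp_add]; ring
    _ = K * (b + 1) := by
        rw [show z + -(3 * z) + z + z = 0 by ring, Real.exp_zero, mul_one]

lemma rpow_mul_exp_le_arctan_sub {α β y : ℝ} (hα : 0 < α) (hβ : 0 < β) (hy : 0 < y)
    (hy1 : y ≤ 1) {n : ℕ} (hn : 1 ≤ n) :
    (n : ℝ) ^ (-(α / 2)) * Real.exp (2 * Real.pi * √(β * n) - Real.pi * n * y) ≤
      9 * (((4 * α / √β ^ 2) ^ α + (√β / 2) ^ (-α)) * (√β + 1)) *
        (y ^ (α - 3 / 2) * Real.exp (Real.pi * β / y)) *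
        (Real.arctan (√y * (√(n + 1 : ℕ) - √β / y)) - Real.arctan (√y * (√n - √β / y))) := by
  have hn' : (1 : ℝ) ≤ n := by exact_mod_cast hn
  have hs1 : 1 ≤ √(n : ℝ) := by rwa [Real.one_le_sqrt]
  have hss : √(n : ℝ) ^ 2 = n := Real.sq_sqrt (by positivity)
  have htt : √((n + 1 : ℕ) : ℝ) ^ 2 = n + 1 := by rw [Real.sq_sqrt (by positivity)]; push_cast; rfl
  have hbb : √β ^ 2 = β := Real.sq_sqrt hβ.le
  have hqq : √y ^ 2 = y := Real.sq_sqrt hy.le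
  have hb : 0 < √β := Real.sqrt_pos.2 hβ
  have hq : 0 < √y := Real.sqrt_pos.2 hy
  have hq1 : √y ≤ 1 := by rwa [Real.sqrt_le_one]
  have hexp : 2 * Real.pi * √(β * n) - Real.pi * n * y =
      Real.pi * β / y + -(Real.pi * ((y * √n - √β) ^ 2 / y)) := by
    rw [Real.sqrt_mul hβ.le]
    field_simp
    linear_combination y ^ 2 * hss + hbb
  have hpow : (n : ℝ) ^ (-(α / 2)) = y ^ α * (y * √n) ^ (-α) := by
    rw [Real.mul_rpow hy.le (by positivity), ← mul_assoc, ← Real.rpow_add hy, add_neg_cancel,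
      Real.rpow_zero, one_mul, Real.sqrt_eq_rpow, ← Real.rpow_mul (by positivity)]
    congr 1; ring
  have hy32 : y ^ α = y ^ (α - 3 / 2) * (y * √y) := by
    rw [Real.sqrt_eq_rpow, ← Real.rpow_one_add' hy.le (by norm_num), ← Real.rpow_add hy]
    congr 1; ring
  have ht0 : 0 ≤ √((n + 1 : ℕ) : ℝ) := Real.sqrt_nonneg _
  have hmain := rpow_neg_mul_exp_neg_le (w := y * √n) hα hb hy hy1 (by nlinarith)
  rw [hexp, hpow, Real.exp_add, hy32]
  generalize √(n : ℝ) = s at *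
  generalize √((n + 1 : ℕ) : ℝ) = t at *
  generalize √β = b at *
  generalize √y = q at *
  have hst : s ≤ t := abs_le_of_sq_le_sq' (by linarith) ht0 |>.2
  have hts : t ≤ 2 * s := abs_le_of_sq_le_sq' (by nlinarith) (by linarith) |>.2
  have hd : 1 / (3 * s) ≤ t - s := by
    rw [div_le_iff₀ (by positivity)]
    nlinarith
  have hd1 : t - s ≤ 1 := by nlinarith
  have hx : (q * (s - b / y)) ^ 2 = (y * s - b) ^ 2 / y := by
    rw [mul_pow, hqq]; field_simp
  have harc := div_le_arctan_add_sub_arctan (x := q * (s - b / y)) (d := q * (t - s))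
    (by nlinarith) (by nlinarith)
  rw [hx, show q * (s - b / y) + q * (t - s) = q * (t - b / y) by ring] at harc
  have hz : 0 ≤ (y * s - b) ^ 2 / y := by positivity
  generalize (y * s - b) ^ 2 / y = z at *
  generalize Real.arctan (q * (t - b / y)) - Real.arctan (q * (s - b / y)) = A at *
  have hK : 0 ≤ ((4 * α / b ^ 2) ^ α + (b / 2) ^ (-α)) * (b + 1) := by positivity
  generalize ((4 * α / b ^ 2) ^ α + (b / 2) ^ (-α)) * (b + 1) = K at *
  have hA : q / (s * (1 + z)) ≤ 9 * A := by
    have : q * (1 / (3 * s)) / (3 * (1 + z)) ≤ A := le_trans (by gcongr) harc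
    calc q / (s * (1 + z)) = 9 * (q * (1 / (3 * s)) / (3 * (1 + z))) := by field_simp; norm_num
      _ ≤ _ := by linarith
  have hE : 0 ≤ y ^ (α - 3 / 2) * Real.exp (Real.pi * β / y) := by positivity
  calc _ = y ^ (α - 3 / 2) * Real.exp (Real.pi * β / y) * (y * q) *
        ((y * s) ^ (-α) * Real.exp (-(Real.pi * z))) := by ring
    _ ≤ y ^ (α - 3 / 2) * Real.exp (Real.pi * β / y) * (y * q) * (K / (y * s * (1 + z))) := by
        gcongr
    _ = K * (y ^ (α - 3 / 2) * Real.exp (Real.pi * β / y)) * (q / (s * (1 + z))) := by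
        field_simp
    _ ≤ K * (y ^ (α - 3 / 2) * Real.exp (Real.pi * β / y)) * (9 * A) := by gcongr
    _ = _ := by ring

/-- For `α, β > 0` and an integer `N > α²/(4π²β)`, there are
`C > 0` and `y₀ > 0` such that for all `0 < y < y₀`,
`Σ_{n ≥ N} n^{-α/2} exp(2π√(βn) − πny) ≤ C · y^{α−3/2} · e^{πβ/y}`. -/
theorem statement7 (α β : ℝ) (hα : 0 < α) (hβ : 0 < β) (N : ℕ)
    (hN : α ^ 2 / (4 * Real.pi ^ 2 * β) < (N : ℝ)) :
    ∃ C : ℝ, 0 < C ∧ ∃ y₀ : ℝ, 0 < y₀ ∧ ∀ y : ℝ, 0 < y → y < y₀ →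
      (∑' n : ℕ, if N ≤ n then
          (n : ℝ) ^ (-(α / 2)) * Real.exp (2 * Real.pi * Real.sqrt (β * n) - Real.pi * n * y)
        else 0)
        ≤ C * y ^ (α - 3 / 2) * Real.exp (Real.pi * β / y) := by
  have hb : 0 < √β := Real.sqrt_pos.2 hβ
  have hN1 : 1 ≤ N := by
    have : (0 : ℝ) < N := lt_of_le_of_lt (by positivity) hN
    exact_mod_cast this
  set K := ((4 * α / √β ^ 2) ^ α + (√β / 2) ^ (-α)) * (√β + 1) with hKdef
  have hK : 0 < K := by positivity
  refine ⟨9 * K * Real.pi, by positivity, 1, one_pos, fun y hy hy1 => ?_⟩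
  set E := y ^ (α - 3 / 2) * Real.exp (Real.pi * β / y) with hE
  have hE0 : 0 ≤ E := by positivity
  set F : ℕ → ℝ := fun n => Real.arctan (√y * (√n - √β / y)) with hF
  refine Real.tsum_le_of_sum_range_le (fun n => by positivity) fun m => ?_
  calc _ ≤ ∑ n ∈ Finset.range m, 9 * K * E * (F (n + 1) - F n) := by
        refine Finset.sum_le_sum fun n _ => ?_
        split_ifs with h
        · exact rpow_mul_exp_le_arctan_sub hα hβ hy hy1.le (hN1.trans h)
        · have : F n ≤ F (n + 1) := by
            apply Real.arctan_mono
            gcongr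
            omega
          have := sub_nonneg.2 this
          positivity
    _ = 9 * K * E * (F m - F 0) := by rw [← Finset.mul_sum, Finset.sum_range_sub]
    _ ≤ 9 * K * E * Real.pi := by
        gcongr
        simp only [hF]
        linarith [Real.arctan_lt_pi_div_two (√y * (√m - √β / y)),
          Real.neg_pi_div_two_lt_arctan (√y * (√(0 : ℕ) - √β / y))]
    _ = _ := by rw [hE]; ring
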